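/- Let d ∈ {1,2,3} and let Ω ⊆ ℝ^d be a nonempty bounded open set, and let b, c > 0 and k, σ ∈ ℝ. There exist constants ε₀ > 0 and C > 0 (depending only on d, Ω, b, c, k, σ) such that: for every admissible ψ solving the Blackstock equation ψ_tt − c²(1 − 2k ψ_t)Δψ − b Δψ_t + 2σ ∇ψ·∇ψ_t = 0 on [0,∞) × Ω, if E(0) ≤ ε₀ then E(t) + D(t) ≤ C E(0) for all t ≥ 0. -/

import Mathlib

open MeasureTheory Real

noncomputable section

/-- Euclidean space ℝ^d. -/
abbrev Spc (d : ℕ) := EuclideanSpace ℝ (Fin d)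

variable {d : ℕ}

/-- Spatial Laplacian: sum of second derivatives in the coordinate directions. -/
def lap (g : Spc d → ℝ) (x : Spc d) : ℝ :=
  ∑ i, fderiv ℝ (fun y => fderiv ℝ g y (EuclideanSpace.single i 1)) x (EuclideanSpace.single i 1)

/-- Squared L²(Ω) norm: ‖g‖² = ∫_Ω g². -/
def sqL2 (Ω : Set (Spc d)) (g : Spc d → ℝ) : ℝ := ∫ x in Ω, (g x) ^ 2

/-- Squared L²(Ω) norm of the gradient: ‖∇g‖² = ∫_Ω |∇g|². -/
def sqGrad (Ω : Set (Spc d)) (g : Spc d → ℝ) : ℝ := ∫ x in Ω, ‖gradient g x‖ ^ 2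

/-- Squared L²(Ω) norm of the Hessian: ‖D²g‖² = ∫_Ω |D²g|². -/
def sqHess (Ω : Set (Spc d)) (g : Spc d → ℝ) : ℝ := ∫ x in Ω, ‖iteratedFDeriv ℝ 2 g x‖ ^ 2

/-- Squared H¹(Ω) norm. -/
def sqH1 (Ω : Set (Spc d)) (g : Spc d → ℝ) : ℝ := sqL2 Ω g + sqGrad Ω g

/-- Squared H²(Ω) norm. -/
def sqH2 (Ω : Set (Spc d)) (g : Spc d → ℝ) : ℝ := sqL2 Ω g + sqGrad Ω g + sqHess Ω g

/-- H⁻¹(Ω) norm by duality against smooth compactly supported test functions. -/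
def negH1 (Ω : Set (Spc d)) (g : Spc d → ℝ) : ℝ :=
  sSup { r : ℝ | ∃ φ : Spc d → ℝ, ContDiff ℝ (⊤ : ℕ∞) φ ∧ HasCompactSupport φ ∧ tsupport φ ⊆ Ω ∧
      (∫ x in Ω, ‖gradient φ x‖ ^ 2) ≤ 1 ∧ r = ∫ x in Ω, g x * φ x }

/-- Admissible: smooth in (t,x), with spatial support in a fixed compact subset of Ω. -/
def Admissible (Ω : Set (Spc d)) (w : ℝ → Spc d → ℝ) : Prop :=
  ContDiff ℝ (⊤ : ℕ∞) (fun p : ℝ × Spc d => w p.1 p.2) ∧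
  ∃ K : Set (Spc d), IsCompact K ∧ K ⊆ Ω ∧ ∀ t, Function.support (w t) ⊆ K

/-- Inner product of two spatial gradients: ∇g·∇h. -/
def gdot (g h : Spc d → ℝ) (x : Spc d) : ℝ := @inner ℝ _ _ (gradient g x) (gradient h x)

/-- Time derivative. -/
def tderiv (w : ℝ → Spc d → ℝ) (t : ℝ) (x : Spc d) : ℝ := deriv (fun s => w s x) t

/-- The Blackstock equation ψ_tt − c²(1 − 2k ψ_t)Δψ − b Δψ_t + 2σ ∇ψ·∇ψ_t = 0
holds at time `t` on `Ω`. -/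
def IsBlackstock (Ω : Set (Spc d)) (b c k σ : ℝ) (ψ : ℝ → Spc d → ℝ) (t : ℝ) : Prop :=
  ∀ x ∈ Ω,
    (tderiv (tderiv ψ) t x - c ^ 2 * (1 - 2 * k * tderiv ψ t x) * lap (ψ t) x
      - b * lap (tderiv ψ t) x
      + 2 * σ * gdot (ψ t) (tderiv ψ t) x) = 0

/-- Energy E(t). -/
def energy (Ω : Set (Spc d)) (b c : ℝ) (ψ : ℝ → Spc d → ℝ) (t : ℝ) : ℝ :=
  (1 / 2) * sqL2 Ω (tderiv ψ t) + (c ^ 2 / 2) * sqGrad Ω (ψ t)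
    + (c ^ 2 / (2 * b)) * sqL2 Ω (lap (ψ t)) + sqGrad Ω (tderiv ψ t)

/-- Dissipation D(t). -/
def dissip (Ω : Set (Spc d)) (ψ : ℝ → Spc d → ℝ) (t : ℝ) : ℝ :=
  ∫ s in (0:ℝ)..t,
    (sqGrad Ω (tderiv ψ s) + sqL2 Ω (lap (tderiv ψ s)) + sqGrad Ω (ψ s)
      + sqL2 Ω (lap (ψ s)) + sqL2 Ω (tderiv (tderiv ψ) s))

/-- Supremum of a function of time over [0,T]. -/
def supIcc (T : ℝ) (f : ℝ → ℝ) : ℝ := ⨆ t : Set.Icc (0:ℝ) T, f t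

/-- f := −2k c² ψ_t Δψ − 2σ ∇ψ·∇ψ_t, the right-hand side nonlinearity. -/
def blackF (c k σ : ℝ) (ψ : ℝ → Spc d → ℝ) (t : ℝ) (x : Spc d) : ℝ :=
  -(2 * k * c ^ 2) * tderiv ψ t x * lap (ψ t) x - 2 * σ * gdot (ψ t) (tderiv ψ t) x

/-- The nonlocal heat equation v_t − b Δv − c² Δψ = f (with v = ψ_t) holds at time `t` on `Ω`. -/
def IsHeat (Ω : Set (Spc d)) (b c : ℝ) (ψ f : ℝ → Spc d → ℝ) (t : ℝ) : Prop :=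
  ∀ x ∈ Ω,
    tderiv (tderiv ψ) t x - b * lap (tderiv ψ t) x - c ^ 2 * lap (ψ t) x = f t x

/-- The linearized Blackstock equation
ψ_tt − c²(1 − 2k α)Δψ − b Δψ_t + 2σ ∇ψ·∇α = f̃ holds at time `t` on `Ω`. -/
def IsLinBlackstock (Ω : Set (Spc d)) (b c k σ : ℝ) (α ψ f : ℝ → Spc d → ℝ) (t : ℝ) : Prop :=
  ∀ x ∈ Ω,
    tderiv (tderiv ψ) t x - c ^ 2 * (1 - 2 * k * α t x) * lap (ψ t) x
      - b * lap (tderiv ψ t) x + 2 * σ * gdot (ψ t) (α t) x = f t x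

/-- Time-weighted norm N_T^v for the velocity variable. -/
def normV (Ω : Set (Spc d)) (T : ℝ) (α : ℝ → Spc d → ℝ) : ℝ :=
  supIcc T (fun t => Real.sqrt (sqH1 Ω (α t)))
    + Real.sqrt (∫ t in (0:ℝ)..T, (sqL2 Ω (α t) + sqGrad Ω (α t) + sqL2 Ω (lap (α t))))
    + Real.sqrt (∫ t in (0:ℝ)..T, sqL2 Ω (tderiv α t))
    + supIcc T (fun t => Real.sqrt t * Real.sqrt (sqL2 Ω (tderiv α t)))
    + Real.sqrt (∫ t in (0:ℝ)..T, t * sqGrad Ω (tderiv α t))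
    + supIcc T (fun t => Real.sqrt t * Real.sqrt (sqL2 Ω (lap (α t))))

/-- Time-weighted solution norm N_T(ψ) = sup_{[0,T]} ‖ψ(t)‖_{H²} + N_T^v(ψ_t). -/
def normX (Ω : Set (Spc d)) (T : ℝ) (ψ : ℝ → Spc d → ℝ) : ℝ :=
  supIcc T (fun t => Real.sqrt (sqH2 Ω (ψ t))) + normV Ω T (tderiv ψ)


open scoped ContDiff SchwartzMap FourierTransform Laplacian LineDeriv

/-- Partial derivative in the `i`-th coordinate direction. -/
def pd (i : Fin d) (g : Spc d → ℝ) : Spc d → ℝ :=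
  fun x => fderiv ℝ g x (EuclideanSpace.single i 1)

/-- Smooth functions supported in `K`. -/
def TF (K : Set (Spc d)) (g : Spc d → ℝ) : Prop :=
  ContDiff ℝ ∞ g ∧ Function.support g ⊆ K

lemma lap_eq (g : Spc d → ℝ) (x : Spc d) : lap g x = ∑ i, pd i (pd i g) x := rfl

lemma lap_eq' (g : Spc d → ℝ) : lap g = fun x => ∑ i, pd i (pd i g) x := rfl

section static
variable {K : Set (Spc d)} {g h : Spc d → ℝ}

lemma TF.differentiable (hg : TF K g) : Differentiable ℝ g :=
  hg.1.differentiable (by simp)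

lemma TF.cont (hg : TF K g) : Continuous g := hg.1.continuous

lemma TF.hcs (hK : IsCompact K) (hg : TF K g) : HasCompactSupport g :=
  HasCompactSupport.of_support_subset_isCompact hK hg.2

lemma TF.integrable (hK : IsCompact K) (hg : TF K g) : Integrable g :=
  hg.cont.integrable_of_hasCompactSupport (hg.hcs hK)

lemma TF.zero (hg : TF K g) {x : Spc d} (hx : x ∉ K) : g x = 0 := by
  by_contra h
  exact hx (hg.2 h)

lemma TF.pd (hK : IsCompact K) (hg : TF K g) (i : Fin d) : TF K (pd i g) := by
  refine ⟨?_, ?_⟩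
  · have := hg.1.fderiv_right (m := ∞) (by simp)
    exact this.clm_apply contDiff_const
  · intro x hx
    have h1 : x ∈ tsupport g := by
      apply support_fderiv_subset ℝ
      intro h0
      apply hx
      simp [_root_.pd, h0]
    exact (closure_minimal hg.2 hK.isClosed) h1

lemma TF.mul_left (hg : TF K g) (hh : ContDiff ℝ ∞ h) : TF K (fun x => h x * g x) :=
  ⟨hh.mul hg.1, fun x hx => hg.2 (by
    intro h0; apply hx; simp [h0])⟩

lemma TF.mul (hg : TF K g) (hh : TF K h) : TF K (fun x => g x * h x) :=
  hh.mul_left hg.1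

lemma TF.add (hg : TF K g) (hh : TF K h) : TF K (fun x => g x + h x) :=
  ⟨hg.1.add hh.1, fun x hx => by
    by_contra hk; apply hx; simp [hg.zero hk, hh.zero hk]⟩

lemma TF.pow (hg : TF K g) (n : ℕ) (hn : n ≠ 0) : TF K (fun x => g x ^ n) :=
  ⟨hg.1.pow n, fun x hx => by
    by_contra hk; apply hx; simp [hg.zero hk, hn]⟩

lemma TF.sum {ι : Type*} (s : Finset ι) {G : ι → Spc d → ℝ} (hG : ∀ i, TF K (G i)) :
    TF K (fun x => ∑ i ∈ s, G i x) :=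
  ⟨ContDiff.sum fun i _ => (hG i).1, fun x hx => by
    by_contra hk; apply hx; simp [fun i => (hG i).zero hk]⟩

lemma TF.lap (hK : IsCompact K) (hg : TF K g) : TF K (lap g) :=
  TF.sum _ fun i => (hg.pd hK i).pd hK i

lemma pd_mul (i : Fin d) (hg : Differentiable ℝ g) (hh : Differentiable ℝ h) (x : Spc d) :
    pd i (fun y => g y * h y) x = pd i g x * h x + g x * pd i h x := by
  have := fderiv_fun_mul (hg x) (hh x)
  simp only [pd, this]
  simp
  ring

lemma pd_pow (i : Fin d) (n : ℕ) (hg : Differentiable ℝ g) (x : Spc d) :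
    pd i (fun y => g y ^ n) x = n * g x ^ (n - 1) * pd i g x := by
  have := fderiv_fun_pow n (hg x)
  simp only [pd, this]
  simp

lemma pd_comm (i j : Fin d) (hg : ContDiff ℝ ∞ g) (x : Spc d) :
    pd i (pd j g) x = pd j (pd i g) x := by
  have hd : DifferentiableAt ℝ (fderiv ℝ g) x :=
    ((hg.fderiv_right (m := ∞) (by simp)).differentiable (by simp)) x
  have key : ∀ a b : Fin d, pd a (pd b g) x
      = fderiv ℝ (fderiv ℝ g) x (EuclideanSpace.single a 1) (EuclideanSpace.single b 1) := by
    intro a b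
    unfold pd
    rw [fderiv_clm_apply hd (differentiableAt_const _)]
    simp
  rw [key, key]
  have hs : IsSymmSndFDerivAt ℝ g x := by
    apply ContDiffAt.isSymmSndFDerivAt (n := ∞) hg.contDiffAt
    simp only [minSmoothness_of_isRCLikeNormedField]
    exact WithTop.coe_le_coe.2 (le_top : (2 : ℕ∞) ≤ ⊤)
  exact hs _ _

/-- Integration by parts. -/
lemma ibp (hK : IsCompact K) (i : Fin d) (hg : TF K g) (hh : TF K h) :
    ∫ x, g x * pd i h x = - ∫ x, pd i g x * h x :=
  integral_mul_fderiv_eq_neg_fderiv_mul_of_integrable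
    (((hg.pd hK i).mul hh).integrable hK) ((hg.mul (hh.pd hK i)).integrable hK)
    ((hg.mul hh).integrable hK) (fun x _ => hg.differentiable x) (fun x _ => hh.differentiable x)

/-- Cauchy-Schwarz. -/
lemma cs {α : Type*} [MeasurableSpace α] {μ : Measure α} {f g : α → ℝ}
    (hf : Integrable (fun x => f x ^ 2) μ)
    (hg : Integrable (fun x => g x ^ 2) μ) (hfg : Integrable (fun x => f x * g x) μ) :
    (∫ x, f x * g x ∂μ) ^ 2 ≤ (∫ x, f x ^ 2 ∂μ) * ∫ x, g x ^ 2 ∂μ := by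
  have key : ∀ s : ℝ, 0 ≤ (∫ x, g x ^ 2 ∂μ) * (s * s) + (2 * ∫ x, f x * g x ∂μ) * s
      + ∫ x, f x ^ 2 ∂μ := by
    intro s
    have h0 : 0 ≤ ∫ x, (f x + s * g x) ^ 2 ∂μ := integral_nonneg fun x => sq_nonneg _
    have h1 : ∫ x, (f x + s * g x) ^ 2 ∂μ
        = ∫ x, (f x ^ 2 + ((2 * s) * (f x * g x) + (s * s) * g x ^ 2)) ∂μ := by
      congr 1; ext x; ring
    have i3 : Integrable (fun x => (2 * s) * (f x * g x) + (s * s) * g x ^ 2) μ :=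
      (hfg.const_mul _).add (hg.const_mul _)
    rw [h1, integral_add hf i3, integral_add (hfg.const_mul _) (hg.const_mul _), integral_const_mul, integral_const_mul] at h0
    linarith
  have := discrim_le_zero key
  unfold discrim at this
  nlinarith

lemma TF.cs (hK : IsCompact K) (hg : TF K g) (hh : TF K h) :
    (∫ x, g x * h x) ^ 2 ≤ (∫ x, g x ^ 2) * ∫ x, h x ^ 2 :=
  _root_.cs ((hg.pow 2 (by simp)).integrable hK) ((hh.pow 2 (by simp)).integrable hK)
    ((hg.mul hh).integrable hK)

/-- Poincare inequality. -/
lemma poincare (hK : IsCompact K) (i : Fin d) {R : ℝ} (hR : ∀ x ∈ K, ‖x‖ ≤ R) (hg : TF K g) :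
    ∫ x, g x ^ 2 ≤ 4 * R ^ 2 * ∫ x, pd i g x ^ 2 := by
  have hX : ContDiff ℝ ∞ (fun x : Spc d => x i) := by fun_prop
  have hpX : ∀ x, pd i (fun x : Spc d => x i) x = 1 := by
    intro x
    have : HasFDerivAt (fun x : Spc d => x i) (EuclideanSpace.proj i : Spc d →L[ℝ] ℝ) x :=
      (EuclideanSpace.proj i : Spc d →L[ℝ] ℝ).hasFDerivAt
    simp [pd, this.fderiv]
  have hxg : TF K (fun x => x i * g x) := hg.mul_left hX
  have h1 := ibp hK i hxg hg
  have h2 : ∀ x, pd i (fun y : Spc d => y i * g y) x = g x + x i * pd i g x := by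
    intro x
    rw [pd_mul i (hX.differentiable (by simp)) hg.differentiable, hpX]; ring
  simp_rw [h2] at h1
  have i1 : Integrable (fun x : Spc d => g x ^ 2) := (hg.pow 2 (by simp)).integrable hK
  have i2 : Integrable (fun x : Spc d => (x i * g x) * pd i g x) :=
    (hxg.mul (hg.pd hK i)).integrable hK
  have h3 : ∫ x, (g x + x i * pd i g x) * g x
      = (∫ x, g x ^ 2) + ∫ x : Spc d, (x i * g x) * pd i g x := by
    rw [← integral_add i1 i2]; congr 1; ext x; ring
  have h4 : (∫ x : Spc d, (x i * g x) * pd i g x) ^ 2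
      ≤ (∫ x : Spc d, (x i * g x) ^ 2) * ∫ x, pd i g x ^ 2 := hxg.cs hK (hg.pd hK i)
  have h5 : (∫ x : Spc d, (x i * g x) ^ 2) ≤ R ^ 2 * ∫ x, g x ^ 2 := by
    rw [← integral_const_mul]
    apply integral_mono ((hxg.pow 2 (by simp)).integrable hK) (i1.const_mul _)
    intro x
    by_cases hx : x ∈ K
    · have a1 : |x i| ≤ R := (PiLp.norm_apply_le x i).trans (hR x hx)
      have a2 : (x i) ^ 2 ≤ R ^ 2 := sq_le_sq' (by linarith [neg_abs_le (x i)]) ((le_abs_self _).trans a1)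
      simp only [mul_pow]
      gcongr
    · simp [hg.zero hx]
  set A := ∫ x, g x ^ 2
  set B := ∫ x, pd i g x ^ 2
  have hA : 0 ≤ A := integral_nonneg fun x => sq_nonneg _
  have hB : 0 ≤ B := integral_nonneg fun x => sq_nonneg _
  set I := ∫ x : Spc d, (x i * g x) * pd i g x
  have h6 : A = -2 * I := by linarith
  have h7 : A ^ 2 ≤ 4 * (R ^ 2 * A * B) := by
    have : A ^ 2 = 4 * I ^ 2 := by rw [h6]; ring
    linarith [mul_le_mul_of_nonneg_right h5 hB]
  rcases hA.eq_or_lt with h | h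
  · rw [← h]; positivity
  · nlinarith

lemma pd_ibp2 (hK : IsCompact K) (i j : Fin d) (hg : TF K g) :
    ∫ x, pd i (pd j g) x ^ 2 = ∫ x, pd i (pd i g) x * pd j (pd j g) x := by
  have h1 := ibp hK i ((hg.pd hK j).pd hK i) (hg.pd hK j)
  have h2 := ibp hK j ((hg.pd hK i).pd hK i) (hg.pd hK j)
  have e : ∀ x, pd i (pd i (pd j g)) x = pd j (pd i (pd i g)) x := by
    intro x
    rw [show pd i (pd j g) = pd j (pd i g) from funext fun y => pd_comm i j hg.1 y]
    exact pd_comm i j (hg.pd hK i).1 x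
  simp_rw [e] at h1
  rw [h2, ← h1]; congr 1; ext x; ring

lemma hess_eq (hK : IsCompact K) (hg : TF K g) :
    ∑ i, ∑ j, ∫ x, pd i (pd j g) x ^ 2 = ∫ x, lap g x ^ 2 := by
  simp_rw [lap_eq, sq (Finset.sum _ _), Finset.sum_mul_sum]
  have it : ∀ i j, Integrable (fun x => pd i (pd i g) x * pd j (pd j g) x) := fun i j =>
    (((hg.pd hK i).pd hK i).mul ((hg.pd hK j).pd hK j)).integrable hK
  rw [integral_finsetSum _ fun i _ => integrable_finsetSum _ fun j _ => it i j]
  refine Finset.sum_congr rfl fun i _ => ?_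
  rw [integral_finsetSum _ fun j _ => it i j]
  refine Finset.sum_congr rfl fun j _ => pd_ibp2 hK i j hg

lemma hess_le (hK : IsCompact K) (hg : TF K g) (i j : Fin d) :
    ∫ x, pd i (pd j g) x ^ 2 ≤ ∫ x, lap g x ^ 2 := by
  rw [← hess_eq hK hg]
  have nn : ∀ i j, 0 ≤ ∫ x, pd i (pd j g) x ^ 2 := fun i j => integral_nonneg fun x => sq_nonneg _
  refine (Finset.single_le_sum (f := fun j => ∫ x, pd i (pd j g) x ^ 2)
    (fun j _ => nn i j) (Finset.mem_univ j)).trans ?_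
  exact Finset.single_le_sum (f := fun i => ∑ j, ∫ x, pd i (pd j g) x ^ 2)
    (fun i _ => Finset.sum_nonneg fun j _ => nn i j) (Finset.mem_univ i)

end static


section fourier

/-- Sobolev embedding of `H²` in `L^∞` for Schwartz functions. -/
lemma schwartz_sup (hd : d ≤ 3) (φ : 𝓢(Spc d, ℂ)) (x : Spc d) :
    ‖φ x‖ ^ 2 ≤ (∫ ξ : Spc d, ((1 + ‖ξ‖ ^ 2)⁻¹) ^ 2) * ∫ x, ‖φ x - Δ φ x‖ ^ 2 := by
  set h : 𝓢(Spc d, ℂ) := φ - Δ φ with hh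
  have hF : ∀ ξ, 𝓕 h ξ = (1 + (2 * π) ^ 2 * ‖ξ‖ ^ 2 : ℝ) * 𝓕 φ ξ := by
    intro ξ
    have e1 : 𝓕 (Δ φ) = -(2 * π) ^ 2 • SchwartzMap.smulLeftCLM ℂ (fun ξ : Spc d => ‖ξ‖ ^ 2) (𝓕 φ) := by
      rw [SchwartzMap.laplacian_eq_fourierMultiplierCLM, SchwartzMap.fourierMultiplierCLM_apply,
        ← FourierTransform.fourierInv_smul, FourierTransform.fourier_fourierInv_eq]
    have e2 : 𝓕 h = 𝓕 φ - 𝓕 (Δ φ) := by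
      rw [hh]; exact map_sub (FourierTransform.fourierCLE ℂ 𝓢(Spc d, ℂ)) φ (Δ φ)
    rw [e2, e1]
    simp only [_root_.sub_apply, _root_.smul_apply]
    rw [SchwartzMap.smulLeftCLM_apply_apply (by fun_prop)]
    simp
    ring
  have hF2 : ∀ ξ, ‖𝓕 φ ξ‖ ≤ (1 + ‖ξ‖ ^ 2)⁻¹ * ‖𝓕 h ξ‖ := by
    intro ξ
    have p1 : (1 : ℝ) ≤ (2 * π) ^ 2 := by nlinarith [Real.pi_gt_three]
    have p2 : 1 + ‖ξ‖ ^ 2 ≤ 1 + (2 * π) ^ 2 * ‖ξ‖ ^ 2 := by nlinarith [sq_nonneg ‖ξ‖]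
    rw [hF, norm_mul, Complex.norm_real, Real.norm_of_nonneg (by positivity), ← mul_assoc]
    have : 1 ≤ (1 + ‖ξ‖ ^ 2)⁻¹ * (1 + (2 * π) ^ 2 * ‖ξ‖ ^ 2) := by
      rw [inv_mul_eq_div, one_le_div (by positivity)]; exact p2
    exact le_mul_of_one_le_left (norm_nonneg _) this
  have iw : Integrable (fun ξ : Spc d => ((1 + ‖ξ‖ ^ 2)⁻¹) ^ 2) := by
    have := integrable_rpow_neg_one_add_norm_sq (E := Spc d) (μ := volume) (r := 4) (by
      simp; exact_mod_cast (by omega : d < 4))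
    refine this.congr (Filter.Eventually.of_forall fun ξ => ?_)
    simp only
    rw [show (-4 / 2 : ℝ) = -((2 : ℕ) : ℝ) by norm_num, Real.rpow_neg (by positivity),
      Real.rpow_natCast, inv_pow]
  have ih : Integrable (fun ξ => ‖𝓕 h ξ‖ ^ 2) := by
    have := (𝓕 h).memLp 2 volume
    exact (memLp_two_iff_integrable_sq_norm this.1).1 this
  have iwh : Integrable (fun ξ : Spc d => (1 + ‖ξ‖ ^ 2)⁻¹ * ‖𝓕 h ξ‖) := by
    refine (𝓕 h).integrable.norm.mono' ?_ (Filter.Eventually.of_forall fun ξ => ?_)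
    · have : Continuous (fun ξ : Spc d => (1 + ‖ξ‖ ^ 2)⁻¹) := by
        apply Continuous.inv₀ (by fun_prop)
        intro ξ; positivity
      exact (this.mul (𝓕 h).continuous.norm).aestronglyMeasurable
    · rw [norm_mul, norm_norm, Real.norm_of_nonneg (by positivity)]
      apply mul_le_of_le_one_left (norm_nonneg _)
      apply inv_le_one_of_one_le₀
      nlinarith [sq_nonneg ‖ξ‖]
  have hφ : ‖φ x‖ ≤ ∫ ξ, ‖𝓕 φ ξ‖ := by
    have : φ x = 𝓕⁻ (𝓕 φ) x := by rw [FourierTransform.fourierInv_fourier_eq]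
    rw [this, SchwartzMap.fourierInv_coe, Real.fourierInv_eq]
    refine (norm_integral_le_integral_norm _).trans (le_of_eq ?_)
    simp
  have h1 : ‖φ x‖ ≤ ∫ ξ : Spc d, (1 + ‖ξ‖ ^ 2)⁻¹ * ‖𝓕 h ξ‖ :=
    hφ.trans (integral_mono (𝓕 φ).integrable.norm iwh hF2)
  have h2 := cs iw ih iwh
  calc ‖φ x‖ ^ 2 ≤ (∫ ξ : Spc d, (1 + ‖ξ‖ ^ 2)⁻¹ * ‖𝓕 h ξ‖) ^ 2 := by gcongr
    _ ≤ _ := h2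
    _ = _ := by rw [SchwartzMap.integral_norm_sq_fourier]; rfl

variable {K : Set (Spc d)} {g h : Spc d → ℝ}

lemma sup_aux (hd : d ≤ 3) (hK : IsCompact K) (hg : TF K g) (x : Spc d) :
    g x ^ 2 ≤ (∫ ξ : Spc d, ((1 + ‖ξ‖ ^ 2)⁻¹) ^ 2) * ∫ x, (g x - lap g x) ^ 2 := by
  have c1 : HasCompactSupport (fun x => (g x : ℂ)) := (hg.hcs hK).comp_left (g := Complex.ofReal) (by simp)
  have c2 : ContDiff ℝ ∞ (fun x => (g x : ℂ)) := Complex.ofRealCLM.contDiff.comp hg.1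
  set φ := c1.toSchwartzMap c2 with hφ
  have hval : ∀ x, φ x = (g x : ℂ) := fun x => rfl
  have hder : ∀ (i : Fin d) (G : 𝓢(Spc d, ℂ)) (u : Spc d → ℝ), Differentiable ℝ u →
      (∀ x, G x = (u x : ℂ)) →
      ∀ x, (∂_{(EuclideanSpace.basisFun (Fin d) ℝ) i} G) x = (pd i u x : ℂ) := by
    intro i G u hu hGu x
    rw [SchwartzMap.lineDerivOp_apply_eq_fderiv]
    have : (G : Spc d → ℂ) = fun x => Complex.ofRealCLM (u x) := funext hGu
    rw [this]
    have h2 := (Complex.ofRealCLM.hasFDerivAt.comp x (hu x).hasFDerivAt).fderiv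
    simp only [Function.comp_def] at h2
    rw [h2]
    simp [pd]
  have hlap : ∀ x, (Δ φ) x = (lap g x : ℂ) := by
    intro x
    rw [SchwartzMap.laplacian_eq_sum (EuclideanSpace.basisFun (Fin d) ℝ), lap_eq,
      _root_.sum_apply]
    push_cast
    refine Finset.sum_congr rfl fun i _ => ?_
    exact hder i _ _ (hg.pd hK i).differentiable (hder i _ _ hg.differentiable hval) x
  have := schwartz_sup hd φ x
  simp only [hlap, hval] at this
  simpa [← Complex.ofReal_sub, Complex.norm_real] using this

end fourier


section conseq

lemma l4_bound {K : Set (Spc d)} (hK : IsCompact K) {g : Spc d → ℝ} (hg : TF K g) {S : ℝ}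
    (hS : ∀ x, g x ^ 2 ≤ S) (i : Fin d) :
    ∫ x, pd i g x ^ 4 ≤ 9 * S * ∫ x, lap g x ^ 2 := by
  have hp := hg.pd hK i
  have hpp := hp.pd hK i
  have h1 := ibp hK i (hp.pow 3 (by simp)) hg
  simp_rw [pd_pow i 3 hp.differentiable] at h1
  have e1 : ∫ x, pd i g x ^ 4 = ∫ x, pd i g x ^ 3 * pd i g x := by
    congr 1
  have e2 : ∫ x, ((3 : ℕ) : ℝ) * pd i g x ^ (3 - 1) * pd i (pd i g) x * g x
      = 3 * ∫ x, pd i g x ^ 2 * (g x * pd i (pd i g) x) := by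
    rw [← integral_const_mul]; congr 1; ext x; norm_num; ring
  have h2 := (hp.pow 2 (by simp)).cs hK (hg.mul hpp)
  have e3 : ∫ x, (pd i g x ^ 2) ^ 2 = ∫ x, pd i g x ^ 4 := by
    congr 1; ext x; ring
  have h3 : ∫ x, (g x * pd i (pd i g) x) ^ 2 ≤ S * ∫ x, lap g x ^ 2 := by
    calc _ ≤ ∫ x, S * pd i (pd i g) x ^ 2 := by
          apply integral_mono (((hg.mul hpp).pow 2 (by simp)).integrable hK)
            (((hpp.pow 2 (by simp)).integrable hK).const_mul _)
          intro x
          simp only [mul_pow]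
          exact mul_le_mul_of_nonneg_right (hS x) (sq_nonneg _)
      _ ≤ _ := by
          rw [integral_const_mul]
          exact mul_le_mul_of_nonneg_left (hess_le hK hg i i) ((sq_nonneg _).trans (hS 0))
  rw [e3] at h2
  set A := ∫ x, pd i g x ^ 4
  have hA : 0 ≤ A := integral_nonneg fun x => by positivity
  have h4 : A = -(3 * ∫ x, pd i g x ^ 2 * (g x * pd i (pd i g) x)) := by
    rw [e1, h1, e2]
  have h5 : A ^ 2 ≤ 9 * (A * (S * ∫ x, lap g x ^ 2)) := by
    have : A ^ 2 = 9 * (∫ x, pd i g x ^ 2 * (g x * pd i (pd i g) x)) ^ 2 := by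
      rw [h4]; ring
    linarith [mul_le_mul_of_nonneg_left h3 hA]
  have hN : 0 ≤ S * ∫ x, lap g x ^ 2 := le_trans (integral_nonneg fun x => sq_nonneg _) h3
  rcases hA.eq_or_lt with h | h
  · rw [← h]; linarith
  · nlinarith

lemma static_main (hd0 : 0 < d) (hd : d ≤ 3) {Ω : Set (Spc d)} (hbd : Bornology.IsBounded Ω) :
    ∃ C : ℝ, 0 < C ∧ ∀ K : Set (Spc d), IsCompact K → K ⊆ Ω → ∀ g h : Spc d → ℝ,
      TF K g → TF K h →
      (∫ x, g x ^ 2 ≤ C * ∑ i, ∫ x, pd i g x ^ 2) ∧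
      (∑ i, ∫ x, pd i g x ^ 2 ≤ C * ∫ x, lap g x ^ 2) ∧
      (∫ x, (g x * lap h x) ^ 2 ≤ C * (∫ x, lap g x ^ 2) * ∫ x, lap h x ^ 2) ∧
      (∫ x, (∑ i, pd i g x * pd i h x) ^ 2 ≤ C * (∫ x, lap g x ^ 2) * ∫ x, lap h x ^ 2) := by
  obtain ⟨R, hR⟩ := hbd.exists_norm_le
  set S0 := ∫ ξ : Spc d, ((1 + ‖ξ‖ ^ 2)⁻¹) ^ 2 with hS0
  have S0n : 0 ≤ S0 := integral_nonneg fun x => sq_nonneg _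
  set S1 := S0 * (2 * (16 * R ^ 4) + 2) with hS1
  have S1n : 0 ≤ S1 := by positivity
  set C := 1 + 4 * R ^ 2 + d * (4 * R ^ 2) + S1 + d * (d * (9 * S1)) with hC
  have t1 : 0 ≤ 4 * R ^ 2 := by positivity
  have t2 : 0 ≤ d * (4 * R ^ 2) := by positivity
  have t3 : 0 ≤ d * (d * (9 * S1)) := by positivity
  refine ⟨C, by positivity, fun K hK hKΩ => ?_⟩
  have hRK : ∀ x ∈ K, ‖x‖ ≤ R := fun x hx => hR x (hKΩ hx)
  have nn : ∀ g : Spc d → ℝ, 0 ≤ ∫ x, g x ^ 2 := fun g => integral_nonneg fun x => sq_nonneg _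
  have i0 : Fin d := ⟨0, hd0⟩
  have P1 : ∀ g, TF K g → ∀ i, ∫ x, pd i g x ^ 2 ≤ 4 * R ^ 2 * ∫ x, lap g x ^ 2 := by
    intro g hg i
    refine (poincare hK i hRK (hg.pd hK i)).trans ?_
    exact mul_le_mul_of_nonneg_left (hess_le hK hg i i) t1
  have P0 : ∀ g, TF K g → ∫ x, g x ^ 2 ≤ 16 * R ^ 4 * ∫ x, lap g x ^ 2 := by
    intro g hg
    refine (poincare hK i0 hRK hg).trans ?_
    have := mul_le_mul_of_nonneg_left (P1 g hg i0) t1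
    linarith
  have PS : ∀ g, TF K g → ∀ x, g x ^ 2 ≤ S1 * ∫ x, lap g x ^ 2 := by
    intro g hg x
    refine (sup_aux hd hK hg x).trans ?_
    rw [hS1, mul_assoc]
    apply mul_le_mul_of_nonneg_left _ S0n
    have j1 : Integrable (fun x => g x ^ 2) := (hg.pow 2 (by simp)).integrable hK
    have j2 : Integrable (fun x => lap g x ^ 2) := ((hg.lap hK).pow 2 (by simp)).integrable hK
    have : ∫ x, (g x - lap g x) ^ 2 ≤ ∫ x, (2 * g x ^ 2 + 2 * lap g x ^ 2) := by
      apply integral_mono_of_nonneg (Filter.Eventually.of_forall fun x => sq_nonneg _)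
        ((j1.const_mul _).add (j2.const_mul _))
      refine Filter.Eventually.of_forall fun x => ?_
      show (g x - lap g x) ^ 2 ≤ 2 * g x ^ 2 + 2 * lap g x ^ 2
      nlinarith [sq_nonneg (g x + lap g x)]
    rw [integral_add (j1.const_mul _) (j2.const_mul _), integral_const_mul, integral_const_mul] at this
    linarith [P0 g hg]
  intro g h hg hh
  have Ng := nn (lap g)
  have Nh := nn (lap h)
  refine ⟨?_, ?_, ?_, ?_⟩
  · have h1 := poincare hK i0 hRK hg
    have h2 : ∫ x, pd i0 g x ^ 2 ≤ ∑ i, ∫ x, pd i g x ^ 2 :=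
      Finset.single_le_sum (f := fun i => ∫ x, pd i g x ^ 2) (fun i _ => nn _) (Finset.mem_univ i0)
    have h3 : 0 ≤ ∑ i, ∫ x, pd i g x ^ 2 := Finset.sum_nonneg fun i _ => nn _
    calc _ ≤ _ := h1
      _ ≤ 4 * R ^ 2 * ∑ i, ∫ x, pd i g x ^ 2 := mul_le_mul_of_nonneg_left h2 t1
      _ ≤ _ := mul_le_mul_of_nonneg_right (by linarith) h3
  · calc ∑ i, ∫ x, pd i g x ^ 2 ≤ ∑ i : Fin d, 4 * R ^ 2 * ∫ x, lap g x ^ 2 :=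
          Finset.sum_le_sum fun i _ => P1 g hg i
      _ = (d * (4 * R ^ 2)) * ∫ x, lap g x ^ 2 := by simp; ring
      _ ≤ _ := mul_le_mul_of_nonneg_right (by linarith) Ng
  · have hl := hh.lap hK
    calc ∫ x, (g x * lap h x) ^ 2 ≤ ∫ x, (S1 * ∫ x, lap g x ^ 2) * lap h x ^ 2 := by
          apply integral_mono (((hg.mul hl).pow 2 (by simp)).integrable hK)
            (((hl.pow 2 (by simp)).integrable hK).const_mul _)
          intro x
          simp only [mul_pow]
          exact mul_le_mul_of_nonneg_right (PS g hg x) (sq_nonneg _)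
      _ = S1 * (∫ x, lap g x ^ 2) * ∫ x, lap h x ^ 2 := by rw [integral_const_mul]
      _ ≤ _ := by gcongr; linarith
  · have Q : ∀ i, ∫ x, (pd i g x * pd i h x) ^ 2
        ≤ 9 * S1 * (∫ x, lap g x ^ 2) * ∫ x, lap h x ^ 2 := by
      intro i
      have a1 := ((hg.pd hK i).pow 2 (by simp)).cs hK ((hh.pd hK i).pow 2 (by simp))
      have a2 := l4_bound hK hg (PS g hg) i
      have a3 := l4_bound hK hh (PS h hh) i
      simp_rw [← pow_mul, ← mul_pow] at a1
      norm_num only at a1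
      have z3 : 0 ≤ ∫ x, pd i h x ^ 4 := integral_nonneg fun x => by positivity
      apply le_of_sq_le_sq _ (by positivity)
      refine a1.trans ((mul_le_mul a2 a3 z3 (by positivity)).trans (le_of_eq ?_))
      ring
    have hi : ∀ i, Integrable (fun x => (pd i g x * pd i h x) ^ 2) := fun i =>
      (((hg.pd hK i).mul (hh.pd hK i)).pow 2 (by simp)).integrable hK
    calc ∫ x, (∑ i, pd i g x * pd i h x) ^ 2
        ≤ ∫ x, d * ∑ i, (pd i g x * pd i h x) ^ 2 := by
          apply integral_mono_of_nonneg (Filter.Eventually.of_forall fun x => sq_nonneg _)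
            ((integrable_finsetSum _ fun i _ => hi i).const_mul _)
          refine Filter.Eventually.of_forall fun x => ?_
          have := sq_sum_le_card_mul_sum_sq (s := Finset.univ) (f := fun i => pd i g x * pd i h x)
          simpa using this
      _ = d * ∑ i, ∫ x, (pd i g x * pd i h x) ^ 2 := by
          rw [integral_const_mul, integral_finsetSum _ fun i _ => hi i]
      _ ≤ d * ∑ i : Fin d, 9 * S1 * (∫ x, lap g x ^ 2) * ∫ x, lap h x ^ 2 := by
          gcongr with i; exact Q i
      _ = (d * (d * (9 * S1))) * (∫ x, lap g x ^ 2) * ∫ x, lap h x ^ 2 := by simp; ring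
      _ ≤ _ := by gcongr; linarith

lemma green {K : Set (Spc d)} (hK : IsCompact K) {g h : Spc d → ℝ} (hg : TF K g) (hh : TF K h) :
    ∑ i, ∫ x, pd i g x * pd i h x = - ∫ x, g x * lap h x := by
  have : ∫ x, g x * lap h x = ∑ i, ∫ x, g x * pd i (pd i h) x := by
    simp_rw [lap_eq, Finset.mul_sum]
    exact integral_finsetSum _ fun i _ => (hg.mul ((hh.pd hK i).pd hK i)).integrable hK
  rw [this, ← Finset.sum_neg_distrib]
  refine Finset.sum_congr rfl fun i _ => ?_
  rw [ibp hK i hg (hh.pd hK i), neg_neg]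

end conseq


section ode

lemma young {i F a θ : ℝ} (hθ : 0 < θ) (hF : 0 ≤ F) (ha : 0 ≤ a) (h : i ^ 2 ≤ F * a) :
    |i| ≤ (θ * a + F / θ) / 2 := by
  apply abs_le_of_sq_le_sq _ (by positivity)
  have : F * a = (θ * a) * (F / θ) := by field_simp
  nlinarith [sq_nonneg (θ * a - F / θ)]

set_option maxHeartbeats 1000000 in
/-- Abstract form of the differential inequality argument. -/
lemma ode_core (b c C : ℝ) (hb : 0 < b) (hc : 0 < c) (hC : 0 < C) :
    ∃ ε₀ > (0:ℝ), ∃ M > (0:ℝ), ∀ a p q r m a' p' q' r' m' s G : ℝ → ℝ,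
      (∀ t, HasDerivAt a (a' t) t) → (∀ t, HasDerivAt p (p' t) t) →
      (∀ t, HasDerivAt q (q' t) t) → (∀ t, HasDerivAt r (r' t) t) →
      (∀ t, HasDerivAt m (m' t) t) → Continuous G →
      (∀ t, 0 ≤ a t ∧ 0 ≤ p t ∧ 0 ≤ q t ∧ 0 ≤ r t ∧ 0 ≤ s t) →
      (∀ t, a t ≤ C * q t ∧ p t ≤ C * r t ∧ m t ^ 2 ≤ p t * q t) →
      (∀ t, 0 ≤ t → ∃ z F i1 i2 i3 : ℝ, 0 ≤ F ∧ i1 ^ 2 ≤ F * a t ∧ i2 ^ 2 ≤ F * s t ∧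
        i3 ^ 2 ≤ F * r t ∧ F ≤ C * s t * r t ∧
        a' t = -2 * b * q t - 2 * c ^ 2 * m t + 2 * i1 ∧ p' t = 2 * m t ∧
        q' t = -2 * b * s t - 2 * c ^ 2 * z - 2 * i2 ∧ r' t = 2 * z ∧
        m' t = - b * z - c ^ 2 * r t - i3 + q t ∧
        G t ≤ C * (q t + s t + p t + r t + F)) →
      (1 / 2) * a 0 + (c ^ 2 / 2) * p 0 + (c ^ 2 / (2 * b)) * r 0 + q 0 ≤ ε₀ →
      ∀ t, 0 ≤ t →
        (1 / 2) * a t + (c ^ 2 / 2) * p t + (c ^ 2 / (2 * b)) * r t + q t + ∫ τ in (0:ℝ)..t, G τ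
          ≤ M * ((1 / 2) * a 0 + (c ^ 2 / 2) * p 0 + (c ^ 2 / (2 * b)) * r 0 + q 0) := by
  set η := min (b / 2) (min (1 / 2) (c ^ 2 / 2)) with hη
  have η0 : 0 < η := by positivity
  have η1 : η ≤ b / 2 := min_le_left _ _
  have η2 : η ≤ 1 / 2 := (min_le_right _ _).trans (min_le_left _ _)
  have η3 : η ≤ c ^ 2 / 2 := (min_le_right _ _).trans (min_le_right _ _)
  clear_value η
  set θ := b / (2 * C) with hθ
  have θ0 : 0 < θ := by positivity
  have θC : θ * C = b / 2 := by rw [hθ]; field_simp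
  clear_value θ
  set N := (1 / θ + 1 / b + η / c ^ 2) / 2 with hN
  have N0 : 0 < N := by positivity
  -- smallness threshold
  set m0 := b * c ^ 2 / (8 * N * C) with hm0
  have m00 : 0 < m0 := by positivity
  set κ := min (b / 4) (η * c ^ 2 / 2) with hκ
  have κ0 : 0 < κ := by positivity
  have κ1 : κ ≤ b / 4 := min_le_left _ _
  have κ2 : κ ≤ η * c ^ 2 / 2 := min_le_right _ _
  clear_value κ
  have m0e : N * C * (2 * m0 / c ^ 2) = b / 4 := by rw [hm0]; field_simp; norm_num
  clear_value m0
  -- upper equivalence constant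
  set U := 2 + 2 * b + b ^ 2 with hU
  have U0 : 0 < U := by positivity
  set C3 := C * (1 + C + C * (2 * m0 / c ^ 2)) with hC3
  have C30 : 0 < C3 := by positivity
  set W := C3 / κ with hW
  have W0 : 0 < W := by positivity
  have Wκ : W * κ = C3 := by rw [hW]; field_simp
  clear_value W
  set V := 4 + 1 / b with hV
  have V0 : 0 < V := by positivity
  refine ⟨m0 / U, by positivity, (V + W) * U, by positivity, ?_⟩
  intro a p q r m a' p' q' r' m' s G ha hp hq hr hm hG hnn hpc hmain h0
  set L : ℝ → ℝ := fun t => (1 / 2) * a t + (c ^ 2 / 2) * p t + (1 / 2) * q t + (c ^ 2 / 2) * r t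
    + η * (m t + b / 2 * r t) with hL
  set L' : ℝ → ℝ := fun t => (1 / 2) * a' t + (c ^ 2 / 2) * p' t + (1 / 2) * q' t
    + (c ^ 2 / 2) * r' t + η * (m' t + b / 2 * r' t) with hL'
  have hLd : ∀ t, HasDerivAt L (L' t) t := fun t =>
    (((((ha t).const_mul _).add ((hp t).const_mul _)).add ((hq t).const_mul _)).add
      ((hr t).const_mul _)).add (((hm t).add ((hr t).const_mul _)).const_mul _)
  have mb : ∀ t, |m t| ≤ (p t + q t) / 2 := by
    intro t
    obtain ⟨h1, h2, h3, h4, h5⟩ := hnn t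
    apply abs_le_of_sq_le_sq _ (by positivity)
    nlinarith [(hpc t).2.2, sq_nonneg (p t - q t)]
  have mb2 : ∀ t, η * |m t| ≤ c ^ 2 / 4 * p t + 1 / 4 * q t := by
    intro t
    obtain ⟨h1, h2, h3, h4, h5⟩ := hnn t
    nlinarith [mul_le_mul_of_nonneg_left (mb t) η0.le, mul_le_mul_of_nonneg_right η3 h2,
      mul_le_mul_of_nonneg_right η2 h3]
  have Llow : ∀ t, (1 / 2) * a t + (c ^ 2 / 4) * p t + (1 / 4) * q t + (c ^ 2 / 2) * r t ≤ L t := by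
    intro t
    obtain ⟨h1, h2, h3, h4, h5⟩ := hnn t
    have := mul_le_mul_of_nonneg_left (neg_abs_le (m t)) η0.le
    have h6 : 0 ≤ η * (b / 2 * r t) := by positivity
    have := mb2 t
    simp only [hL]; linarith
  have Lup : ∀ t, L t ≤ U * ((1 / 2) * a t + (c ^ 2 / 2) * p t + (c ^ 2 / (2 * b)) * r t + q t) := by
    intro t
    obtain ⟨h1, h2, h3, h4, h5⟩ := hnn t
    have e1 := mul_le_mul_of_nonneg_left (le_abs_self (m t)) η0.le
    have e2 := mul_le_mul_of_nonneg_right η3 (by positivity : 0 ≤ b / 2 * r t)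
    have e3 := mb2 t
    have e4 : U * ((c ^ 2 / (2 * b)) * r t) = c ^ 2 / b * r t + c ^ 2 * r t
        + b * (c ^ 2 * r t) / 2 := by
      rw [hU]; field_simp
    have e5 : 0 ≤ c ^ 2 / b * r t := by positivity
    have e6 : 0 ≤ b * a t := by positivity
    have e7 : 0 ≤ b * q t := by positivity
    have e8 : 0 ≤ b * (c ^ 2 * p t) := by positivity
    have e9 : 0 ≤ c ^ 2 * p t := by positivity
    have e11 : 0 ≤ b * (c ^ 2 * r t) := by positivity
    have e10 : U * ((1 / 2) * a t + (c ^ 2 / 2) * p t + (c ^ 2 / (2 * b)) * r t + q t)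
      = U * ((1 / 2) * a t + (c ^ 2 / 2) * p t + q t) + (c ^ 2 / b * r t + c ^ 2 * r t
        + b * (c ^ 2 * r t) / 2) := by
      rw [← e4]; ring
    rw [e10]
    have e12 : 0 ≤ c ^ 2 * r t := by positivity
    have e13 : 0 ≤ b ^ 2 * ((1 / 2) * a t + (c ^ 2 / 2) * p t + q t) := by positivity
    simp only [hL, hU]
    linarith
  have Elow : ∀ t, (1 / 2) * a t + (c ^ 2 / 2) * p t + (c ^ 2 / (2 * b)) * r t + q t ≤ V * L t := by
    intro t
    obtain ⟨h1, h2, h3, h4, h5⟩ := hnn t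
    have e1 := mul_le_mul_of_nonneg_left (Llow t) V0.le
    have e5 : 1 / b * (c ^ 2 / 2 * r t) = c ^ 2 / (2 * b) * r t := by field_simp
    have e9 : 0 ≤ c ^ 2 * p t := by positivity
    have e10 : 0 ≤ c ^ 2 * r t := by positivity
    have e11 : 0 ≤ 1 / b * (1 / 2 * a t + c ^ 2 / 4 * p t + 1 / 4 * q t) := by positivity
    rw [hV] at e1 ⊢
    linarith
  -- main differential inequality
  have hdiff : ∀ t, 0 ≤ t → L t ≤ m0 → L' t ≤ -κ * (q t + s t + r t) ∧
      G t ≤ C3 * (q t + s t + r t) := by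
    intro t ht hLm
    obtain ⟨h1, h2, h3, h4, h5⟩ := hnn t
    obtain ⟨z, F, i1, i2, i3, hF, hi1, hi2, hi3, hFC, ea, ep, eq, er, em, hGt⟩ := hmain t ht
    obtain ⟨hac, hpcr, -⟩ := hpc t
    have hrm : r t ≤ 2 * m0 / c ^ 2 := by
      rw [le_div_iff₀ (by positivity)]
      have := Llow t
      have e9 : 0 ≤ c ^ 2 * p t := by positivity
      linarith
    have hF2 : F ≤ C * (2 * m0 / c ^ 2) * s t := by
      refine hFC.trans ?_
      have := mul_le_mul_of_nonneg_left hrm (by positivity : 0 ≤ C * s t)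
      linarith
    constructor
    · have y1 := (le_abs_self _).trans (young θ0 hF h1 hi1)
      have y2 := (neg_le_abs _).trans (young hb hF h5 hi2)
      have y3 := mul_le_mul_of_nonneg_left
        ((neg_le_abs _).trans (young (by positivity : 0 < c ^ 2) hF h4 hi3)) η0.le
      have y4 : θ * a t ≤ b / 2 * q t := by
        rw [← θC, mul_assoc]; exact mul_le_mul_of_nonneg_left hac θ0.le
      have y5 : N * F ≤ b / 4 * s t := by
        refine (mul_le_mul_of_nonneg_left hF2 N0.le).trans (le_of_eq ?_)
        rw [← m0e]; ring
      have y6 : N * F = (F / θ + F / b + η * (F / c ^ 2)) / 2 := by rw [hN]; ring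
      have eL : L' t = -b * q t + i1 - b * s t - i2 + η * (q t - c ^ 2 * r t - i3) := by
        simp only [hL', ea, ep, eq, er, em]; ring
      have z1 := mul_le_mul_of_nonneg_right κ1 h3
      have z2 := mul_le_mul_of_nonneg_right κ1 h5
      have z3 := mul_le_mul_of_nonneg_right κ2 h4
      have z4 := mul_le_mul_of_nonneg_right η1 h3
      rw [eL]
      linarith
    · refine hGt.trans ?_
      rw [hC3, mul_assoc]
      apply mul_le_mul_of_nonneg_left _ hC.le
      have w1 : 0 ≤ C * (2 * m0 / c ^ 2) := by positivity
      nlinarith [mul_nonneg w1 h3, mul_nonneg w1 h4, mul_nonneg hC.le h3, mul_nonneg hC.le h5]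
  have hL0 : L 0 ≤ m0 := by
    refine (Lup 0).trans ?_
    have := mul_le_mul_of_nonneg_left h0 U0.le
    rwa [mul_div_cancel₀ _ U0.ne'] at this
  have hLm : ∀ t, 0 ≤ t → L t ≤ m0 := by
    intro t ht
    refine image_le_of_deriv_right_lt_deriv_boundary' (f := L) (f' := L') (a := 0) (b := t)
      (B := fun _ => m0) (B' := fun _ => 0)
      (fun x _ => (hLd x).continuousAt.continuousWithinAt)
      (fun x _ => (hLd x).hasDerivWithinAt) hL0 continuousOn_const
      (fun x _ => hasDerivWithinAt_const _ _ _) ?_ (Set.right_mem_Icc.2 ht)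
    intro x hx hxe
    obtain ⟨h1, h2, h3, h4, h5⟩ := hnn x
    obtain ⟨hac, hpcr, -⟩ := hpc x
    have hd := (hdiff x hx.1 hxe.le).1
    have hpos : 0 < q x + s x + r x := by
      by_contra hneg
      have hq0 : q x = 0 := by linarith
      have hr0 : r x = 0 := by linarith
      have ha0 : a x = 0 := by rw [hq0] at hac; linarith
      have hp0 : p x = 0 := by rw [hr0] at hpcr; linarith
      have := Lup x
      rw [hq0, hr0, ha0, hp0, hxe] at this
      linarith
    have := mul_pos κ0 hpos
    linarith
  -- integrate
  set Φ : ℝ → ℝ := fun t => W * L t + ∫ τ in (0:ℝ)..t, G τ with hΦ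
  have hΦd : ∀ t, HasDerivAt Φ (W * L' t + G t) t := fun t =>
    ((hLd t).const_mul _).add (hG.integral_hasStrictDerivAt 0 t).hasDerivAt
  have hanti : AntitoneOn Φ (Set.Ici 0) := by
    apply antitoneOn_of_deriv_nonpos (convex_Ici 0)
    · exact fun x _ => (hΦd x).continuousAt.continuousWithinAt
    · exact fun x _ => (hΦd x).differentiableAt.differentiableWithinAt
    · intro x hx
      rw [interior_Ici] at hx
      rw [(hΦd x).deriv]
      obtain ⟨d1, d2⟩ := hdiff x (le_of_lt hx) (hLm x (le_of_lt hx))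
      have d3 := mul_le_mul_of_nonneg_left d1 W0.le
      rw [← Wκ] at d2
      linarith
  -- energy decreases
  have hLanti : AntitoneOn L (Set.Ici 0) := by
    apply antitoneOn_of_deriv_nonpos (convex_Ici 0)
    · exact fun x _ => (hLd x).continuousAt.continuousWithinAt
    · exact fun x _ => (hLd x).differentiableAt.differentiableWithinAt
    · intro x hx
      rw [interior_Ici] at hx
      rw [(hLd x).deriv]
      obtain ⟨h1, h2, h3, h4, h5⟩ := hnn x
      obtain ⟨d1, d2⟩ := hdiff x (le_of_lt hx) (hLm x (le_of_lt hx))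
      have : 0 ≤ κ * (q x + s x + r x) := by positivity
      linarith
  intro t ht
  have f1 := hanti (Set.mem_Ici.2 le_rfl) (Set.mem_Ici.2 ht) ht
  have f2 := hLanti (Set.mem_Ici.2 le_rfl) (Set.mem_Ici.2 ht) ht
  simp only [hΦ, intervalIntegral.integral_same, add_zero] at f1
  have hLt : 0 ≤ L t := by
    obtain ⟨h1, h2, h3, h4, h5⟩ := hnn t
    refine le_trans ?_ (Llow t); positivity
  have f3 := mul_nonneg W0.le hLt
  have f4 := Elow t
  have f5 := mul_le_mul_of_nonneg_left f2 V0.le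
  have f6 := mul_le_mul_of_nonneg_left (Lup 0) (by positivity : 0 ≤ V + W)
  linarith

end ode


section time

/-- Space-time smooth functions with spatial support in `K`. -/
def AK (K : Set (Spc d)) (w : ℝ → Spc d → ℝ) : Prop :=
  ContDiff ℝ ∞ (fun p : ℝ × Spc d => w p.1 p.2) ∧ ∀ t, Function.support (w t) ⊆ K

variable {K : Set (Spc d)} {w u : ℝ → Spc d → ℝ}

lemma AK.tf (hw : AK K w) (t : ℝ) : TF K (w t) :=
  ⟨hw.1.comp (contDiff_const.prodMk contDiff_id), hw.2 t⟩

lemma AK.tderiv_eq (hw : AK K w) (t : ℝ) (x : Spc d) :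
    HasDerivAt (fun s => w s x)
      (fderiv ℝ (fun p : ℝ × Spc d => w p.1 p.2) (t, x) (1, 0)) t := by
  have h1 := ((hw.1.differentiable (by simp)) (t, x)).hasFDerivAt
  have h2 : HasDerivAt (fun s : ℝ => (s, x)) ((1 : ℝ), (0 : Spc d)) t :=
    (hasDerivAt_id t).prodMk (hasDerivAt_const t x)
  exact h1.comp_hasDerivAt t h2

lemma AK.pd_eq (hw : AK K w) (i : Fin d) (t : ℝ) (x : Spc d) :
    pd i (w t) x = fderiv ℝ (fun p : ℝ × Spc d => w p.1 p.2) (t, x)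
      (0, EuclideanSpace.single i 1) := by
  have h1 := ((hw.1.differentiable (by simp)) (t, x)).hasFDerivAt
  have h2 : HasFDerivAt (fun y : Spc d => (t, y))
      (ContinuousLinearMap.inr ℝ ℝ (Spc d)) x := hasFDerivAt_prodMk_right t x
  have h3 := (h1.comp x h2).fderiv
  simp only [Function.comp_def] at h3
  unfold pd
  rw [h3]
  simp

lemma AK.hasDerivAt (hw : AK K w) (t : ℝ) (x : Spc d) :
    HasDerivAt (fun s => w s x) (tderiv w t x) t :=
  (hw.tderiv_eq t x).differentiableAt.hasDerivAt

lemma AK.tderiv (hw : AK K w) : AK K (tderiv w) := by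
  constructor
  · have : (fun p : ℝ × Spc d => _root_.tderiv w p.1 p.2)
        = fun p => fderiv ℝ (fun p : ℝ × Spc d => w p.1 p.2) p (1, 0) := by
      ext ⟨t, x⟩
      exact (hw.tderiv_eq t x).deriv
    rw [this]
    exact (hw.1.fderiv_right (m := ∞) (by simp)).clm_apply contDiff_const
  · intro t x hx
    by_contra hk
    apply hx
    have : (fun s => w s x) = fun _ => 0 := funext fun s => (hw.tf s).zero hk
    simp [_root_.tderiv, this]

lemma AK.pd (hK : IsCompact K) (hw : AK K w) (i : Fin d) : AK K (fun t => pd i (w t)) := by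
  constructor
  · have : (fun p : ℝ × Spc d => _root_.pd i (w p.1) p.2)
        = fun p => fderiv ℝ (fun p : ℝ × Spc d => w p.1 p.2) p (0, EuclideanSpace.single i 1) := by
      ext ⟨t, x⟩
      exact hw.pd_eq i t x
    rw [this]
    exact (hw.1.fderiv_right (m := ∞) (by simp)).clm_apply contDiff_const
  · exact fun t => ((hw.tf t).pd hK i).2

lemma AK.mul (hw : AK K w) (hu : AK K u) : AK K (fun t x => w t x * u t x) :=
  ⟨hw.1.mul hu.1, fun t => ((hw.tf t).mul (hu.tf t)).2⟩

lemma AK.sum {ι : Type*} (s : Finset ι) {G : ι → ℝ → Spc d → ℝ} (hG : ∀ i, AK K (G i)) :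
    AK K (fun t x => ∑ i ∈ s, G i t x) :=
  ⟨ContDiff.sum fun i _ => (hG i).1, fun t => (TF.sum s fun i => (hG i).tf t).2⟩

lemma AK.lap (hK : IsCompact K) (hw : AK K w) : AK K (fun t => lap (w t)) :=
  AK.sum Finset.univ fun i => (hw.pd hK i).pd hK i

lemma tderiv_pd (hK : IsCompact K) (hw : AK K w) (i : Fin d) (t : ℝ) (x : Spc d) :
    tderiv (fun t => pd i (w t)) t x = pd i (tderiv w t) x := by
  set W := fun p : ℝ × Spc d => w p.1 p.2 with hW
  have hd : DifferentiableAt ℝ (fderiv ℝ W) (t, x) :=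
    ((hw.1.fderiv_right (m := ∞) (by simp)).differentiable (by simp)) (t, x)
  have e1 : tderiv (fun t => pd i (w t)) t x
      = fderiv ℝ (fderiv ℝ W) (t, x) (1, 0) (0, EuclideanSpace.single i 1) := by
    unfold tderiv
    rw [((hw.pd hK i).tderiv_eq t x).deriv]
    have : (fun p : ℝ × Spc d => pd i (w p.1) p.2)
        = fun p => fderiv ℝ W p (0, EuclideanSpace.single i 1) := by
      ext ⟨t, x⟩
      exact hw.pd_eq i t x
    rw [this, fderiv_clm_apply hd (differentiableAt_const _)]
    simp
  have e2 : pd i (tderiv w t) x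
      = fderiv ℝ (fderiv ℝ W) (t, x) (0, EuclideanSpace.single i 1) (1, 0) := by
    rw [hw.tderiv.pd_eq i t x]
    have : (fun p : ℝ × Spc d => tderiv w p.1 p.2) = fun p => fderiv ℝ W p (1, 0) := by
      ext ⟨t, x⟩
      exact (hw.tderiv_eq t x).deriv
    rw [this, fderiv_clm_apply hd (differentiableAt_const _)]
    simp
  rw [e1, e2]
  have hs : IsSymmSndFDerivAt ℝ W (t, x) := by
    apply ContDiffAt.isSymmSndFDerivAt (n := ∞) hw.1.contDiffAt
    simp only [minSmoothness_of_isRCLikeNormedField]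
    exact WithTop.coe_le_coe.2 (le_top : (2 : ℕ∞) ≤ ⊤)
  exact hs _ _

lemma tderiv_pd' (hK : IsCompact K) (hw : AK K w) (i : Fin d) :
    tderiv (fun t => pd i (w t)) = fun t => pd i (tderiv w t) := by
  ext t x; exact tderiv_pd hK hw i t x

lemma tderiv_lap (hK : IsCompact K) (hw : AK K w) (t : ℝ) (x : Spc d) :
    tderiv (fun t => lap (w t)) t x = lap (tderiv w t) x := by
  have h : HasDerivAt (fun s => lap (w s) x)
      (∑ i, tderiv (fun t => pd i (pd i (w t))) t x) t := by
    have := HasDerivAt.fun_sum (u := Finset.univ)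
      fun (i : Fin d) _ => ((hw.pd hK i).pd hK i).hasDerivAt t x
    exact this
  have h2 : tderiv (fun t => lap (w t)) t x = ∑ i, tderiv (fun t => pd i (pd i (w t))) t x :=
    h.deriv
  rw [h2, lap_eq]
  refine Finset.sum_congr rfl fun i _ => ?_
  rw [tderiv_pd hK (hw.pd hK i) i t x, tderiv_pd' hK hw i]

/-- Differentiation under the integral sign. -/
lemma AK.hasDerivAt_integral (hK : IsCompact K) (hw : AK K w) (t : ℝ) :
    HasDerivAt (fun s => ∫ x, w s x) (∫ x, _root_.tderiv w t x) t := by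
  have hc : Continuous (fun p : ℝ × Spc d => _root_.tderiv w p.1 p.2) := hw.tderiv.1.continuous
  obtain ⟨B, hB⟩ := ((isCompact_Icc (a := t - 1) (b := t + 1)).prod hK).bddAbove_image
    hc.norm.continuousOn
  refine (hasDerivAt_integral_of_dominated_loc_of_deriv_le (s := Set.Icc (t - 1) (t + 1))
    (bound := K.indicator fun _ => B)
    (Icc_mem_nhds (by linarith) (by linarith))
    (Filter.Eventually.of_forall fun s => (hw.tf s).cont.aestronglyMeasurable)
    ((hw.tf t).integrable hK) ((hw.tderiv.tf t).cont.aestronglyMeasurable) ?_ ?_ ?_).2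
  · refine Filter.Eventually.of_forall fun x s hs => ?_
    by_cases hx : x ∈ K
    · rw [Set.indicator_of_mem hx]
      exact hB ⟨(s, x), ⟨hs, hx⟩, rfl⟩
    · rw [Set.indicator_of_notMem hx, (hw.tderiv.tf s).zero hx, norm_zero]
  · exact (integrable_indicator_iff hK.measurableSet).2
      (integrableOn_const hK.measure_lt_top.ne)
  · exact Filter.Eventually.of_forall fun x s _ => hw.hasDerivAt s x

lemma AK.hasDerivAt_mul (hK : IsCompact K) (hw : AK K w) (hu : AK K u) (t : ℝ) :
    HasDerivAt (fun s => ∫ x, w s x * u s x)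
      ((∫ x, _root_.tderiv w t x * u t x) + ∫ x, w t x * _root_.tderiv u t x) t := by
  have h := (hw.mul hu).hasDerivAt_integral hK t
  have e : ∀ x, _root_.tderiv (fun t x => w t x * u t x) t x
      = _root_.tderiv w t x * u t x + w t x * _root_.tderiv u t x := fun x =>
    ((hw.hasDerivAt t x).mul (hu.hasDerivAt t x)).deriv
  simp_rw [e] at h
  rwa [integral_add (((hw.tderiv.tf t).mul (hu.tf t)).integrable hK)
    (((hw.tf t).mul (hu.tderiv.tf t)).integrable hK)] at h

lemma AK.hasDerivAt_sq (hK : IsCompact K) (hw : AK K w) (t : ℝ) :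
    HasDerivAt (fun s => ∫ x, w s x ^ 2) (2 * ∫ x, w t x * _root_.tderiv w t x) t := by
  have h := hw.hasDerivAt_mul hK hw t
  simp_rw [sq]
  convert h using 1
  rw [two_mul]
  congr 2
  ext x; ring

end time


section final
variable {K Ω : Set (Spc d)}

lemma gradient_apply' (g : Spc d → ℝ) (x : Spc d) (i : Fin d) : gradient g x i = pd i g x := by
  have h : inner ℝ (gradient g x) (EuclideanSpace.single i (1 : ℝ)) = pd i g x := by
    unfold gradient pd
    exact InnerProductSpace.toDual_symm_apply
  rw [← h, EuclideanSpace.inner_single_right]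
  simp

lemma gdot_eq (g h : Spc d → ℝ) (x : Spc d) : gdot g h x = ∑ i, pd i g x * pd i h x := by
  unfold gdot
  rw [PiLp.inner_apply]
  refine Finset.sum_congr rfl fun i _ => ?_
  rw [gradient_apply', gradient_apply']
  simp [mul_comm]

lemma sqL2_eq (hKΩ : K ⊆ Ω) {g : Spc d → ℝ} (hg : TF K g) : sqL2 Ω g = ∫ x, g x ^ 2 := by
  apply setIntegral_eq_integral_of_forall_compl_eq_zero
  intro x hx
  simp [hg.zero fun h => hx (hKΩ h)]

lemma sqGrad_eq (hK : IsCompact K) (hKΩ : K ⊆ Ω) {g : Spc d → ℝ} (hg : TF K g) :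
    sqGrad Ω g = ∑ i, ∫ x, pd i g x ^ 2 := by
  unfold sqGrad
  have e : ∀ x, ‖gradient g x‖ ^ 2 = ∑ i, pd i g x ^ 2 := by
    intro x
    rw [EuclideanSpace.norm_sq_eq]
    refine Finset.sum_congr rfl fun i _ => ?_
    rw [gradient_apply']; simp
  simp_rw [e]
  rw [← integral_finsetSum _ fun i _ => ((hg.pd hK i).pow 2 (by simp)).integrable hK]
  apply setIntegral_eq_integral_of_forall_compl_eq_zero
  intro x hx
  simp [fun i => (hg.pd hK i).zero fun h => hx (hKΩ h)]

end final


/-- uniform global energy-dissipation bound for the Blackstock equation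
with small initial energy. -/
theorem blackstock_global_bound (d : ℕ) (hd : d = 1 ∨ d = 2 ∨ d = 3)
    (Ω : Set (Spc d)) (hne : Ω.Nonempty) (hop : IsOpen Ω) (hbd : Bornology.IsBounded Ω)
    (b c k σ : ℝ) (hb : 0 < b) (hc : 0 < c) :
    ∃ ε₀ > (0:ℝ), ∃ C > (0:ℝ),
      ∀ ψ : ℝ → Spc d → ℝ, Admissible Ω ψ →
        (∀ t : ℝ, 0 ≤ t → IsBlackstock Ω b c k σ ψ t) →
        energy Ω b c ψ 0 ≤ ε₀ →
        ∀ t : ℝ, 0 ≤ t →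
          energy Ω b c ψ t + dissip Ω ψ t ≤ C * energy Ω b c ψ 0 := by
  obtain ⟨C0, hC0, hst⟩ := static_main (by omega : 0 < d) (by omega : d ≤ 3) hbd
  set C := C0 + C0 * (8 * k ^ 2 * c ^ 4 + 8 * σ ^ 2) + (4 + 3 * b ^ 2 + 3 * c ^ 4) with hC
  have t1 : 0 ≤ C0 * (8 * k ^ 2 * c ^ 4 + 8 * σ ^ 2) := by positivity
  have t2 : 0 ≤ 3 * b ^ 2 := by positivity
  have t3 : 0 ≤ 3 * c ^ 4 := by positivity
  have hCp : 0 < C := by positivity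
  obtain ⟨ε₀, hε, M, hM, hode⟩ := ode_core b c C hb hc hCp
  refine ⟨ε₀, hε, M, hM, ?_⟩
  rintro ψ ⟨hsm, K, hK, hKΩ, hsupp⟩ heq
  have hψ : AK K ψ := ⟨hsm, hsupp⟩
  set v := tderiv ψ with hv
  have hV : AK K v := hψ.tderiv
  have hVt : AK K (tderiv v) := hV.tderiv
  have nn : ∀ g : Spc d → ℝ, 0 ≤ ∫ x, g x ^ 2 := fun g => integral_nonneg fun x => sq_nonneg _
  set a : ℝ → ℝ := fun t => ∫ x, v t x ^ 2 with ha
  set p : ℝ → ℝ := fun t => ∑ i, ∫ x, pd i (ψ t) x ^ 2 with hp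
  set q : ℝ → ℝ := fun t => ∑ i, ∫ x, pd i (v t) x ^ 2 with hq
  set r : ℝ → ℝ := fun t => ∫ x, lap (ψ t) x ^ 2 with hr
  set s : ℝ → ℝ := fun t => ∫ x, lap (v t) x ^ 2 with hs
  set m : ℝ → ℝ := fun t => ∑ i, ∫ x, pd i (v t) x * pd i (ψ t) x with hm
  set G : ℝ → ℝ := fun t => q t + s t + p t + r t + ∫ x, tderiv v t x ^ 2 with hG
  have Een : ∀ t, energy Ω b c ψ t
      = (1 / 2) * a t + (c ^ 2 / 2) * p t + (c ^ 2 / (2 * b)) * r t + q t := by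
    intro t
    simp only [energy, ← hv, sqL2_eq hKΩ (hV.tf t), sqGrad_eq hK hKΩ (hψ.tf t),
      sqL2_eq hKΩ ((hψ.tf t).lap hK), sqGrad_eq hK hKΩ (hV.tf t), ha, hp, hq, hr]
  have Edi : ∀ t, dissip Ω ψ t = ∫ τ in (0:ℝ)..t, G τ := by
    intro t
    unfold dissip
    congr 1
    ext τ
    simp only [← hv, sqL2_eq hKΩ (hVt.tf τ), sqGrad_eq hK hKΩ (hψ.tf τ),
      sqL2_eq hKΩ ((hψ.tf τ).lap hK), sqGrad_eq hK hKΩ (hV.tf τ),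
      sqL2_eq hKΩ ((hV.tf τ).lap hK), hG, hp, hq, hr, hs]
  simp only [Een, Edi]
  -- time derivatives
  have da : ∀ t, HasDerivAt a (2 * ∫ x, v t x * tderiv v t x) t := fun t => hV.hasDerivAt_sq hK t
  have dgen : ∀ (w : ℝ → Spc d → ℝ), AK K w → ∀ t,
      HasDerivAt (fun t => ∑ i, ∫ x, pd i (w t) x ^ 2)
        (2 * ∑ i, ∫ x, pd i (w t) x * pd i (tderiv w t) x) t := by
    intro w hw t
    have := HasDerivAt.fun_sum (u := Finset.univ)
      fun (i : Fin d) _ => (hw.pd hK i).hasDerivAt_sq hK t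
    simp_rw [tderiv_pd' hK hw] at this
    rwa [← Finset.mul_sum] at this
  have dlap : ∀ (w : ℝ → Spc d → ℝ), AK K w → ∀ t,
      HasDerivAt (fun t => ∫ x, lap (w t) x ^ 2)
        (2 * ∫ x, lap (w t) x * lap (tderiv w t) x) t := by
    intro w hw t
    have := (hw.lap hK).hasDerivAt_sq hK t
    simp_rw [tderiv_lap hK hw] at this
    exact this
  have dp := dgen ψ hψ
  have dq := dgen v hV
  have dr := dlap ψ hψ
  have ds := dlap v hV
  have dm : ∀ t, HasDerivAt m ((∑ i, ∫ x, pd i (tderiv v t) x * pd i (ψ t) x) + q t) t := by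
    intro t
    have := HasDerivAt.fun_sum (u := Finset.univ)
      fun (i : Fin d) _ => (hV.pd hK i).hasDerivAt_mul hK (hψ.pd hK i) t
    simp_rw [tderiv_pd' hK hV, tderiv_pd' hK hψ, ← hv] at this
    rw [Finset.sum_add_distrib] at this
    simp only [hq, sq]
    exact this
  have hGc : Continuous G := by
    have c1 : Continuous q := continuous_iff_continuousAt.2 fun t => (dq t).continuousAt
    have c2 : Continuous s := continuous_iff_continuousAt.2 fun t => (ds t).continuousAt
    have c3 : Continuous p := continuous_iff_continuousAt.2 fun t => (dp t).continuousAt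
    have c4 : Continuous r := continuous_iff_continuousAt.2 fun t => (dr t).continuousAt
    have c5 : Continuous (fun t => ∫ x, tderiv v t x ^ 2) :=
      continuous_iff_continuousAt.2 fun t => (hVt.hasDerivAt_sq hK t).continuousAt
    exact (((c1.add c2).add c3).add c4).add c5
  refine hode a p q r m _ _ _ _ _ s G da dp dq dr dm hGc ?_ ?_ ?_
  · intro t
    exact ⟨nn _, Finset.sum_nonneg fun i _ => nn _, Finset.sum_nonneg fun i _ => nn _, nn _, nn _⟩
  · intro t
    have h1 := (hst K hK hKΩ _ _ (hV.tf t) (hψ.tf t)).1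
    have h2 := (hst K hK hKΩ _ _ (hψ.tf t) (hψ.tf t)).2.1
    have hq0 : 0 ≤ q t := Finset.sum_nonneg fun i _ => nn _
    have hr0 : 0 ≤ r t := nn _
    refine ⟨h1.trans (mul_le_mul_of_nonneg_right (by linarith) hq0),
      h2.trans (mul_le_mul_of_nonneg_right (by linarith) hr0), ?_⟩
    have h3 : ∀ i, (∫ x, pd i (v t) x * pd i (ψ t) x) ^ 2
        ≤ (∫ x, pd i (v t) x ^ 2) * ∫ x, pd i (ψ t) x ^ 2 := fun i =>
      ((hV.tf t).pd hK i).cs hK ((hψ.tf t).pd hK i)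
    have h4 := Finset.sum_sq_le_sum_mul_sum_of_sq_le_mul Finset.univ
      (r := fun i => ∫ x, pd i (v t) x * pd i (ψ t) x)
      (f := fun i => ∫ x, pd i (v t) x ^ 2) (g := fun i => ∫ x, pd i (ψ t) x ^ 2)
      (fun i _ => nn _) (fun i _ => nn _) (fun i _ => h3 i)
    rw [mul_comm (p t)]
    exact h4
  · intro t ht
    set f : Spc d → ℝ := fun x => -(2 * k * c ^ 2) * (v t x * lap (ψ t) x)
      + -(2 * σ) * ∑ i, pd i (ψ t) x * pd i (v t) x with hf
    have T1 : TF K (fun x => v t x * lap (ψ t) x) := (hV.tf t).mul ((hψ.tf t).lap hK)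
    have T2 : TF K (fun x => ∑ i, pd i (ψ t) x * pd i (v t) x) :=
      TF.sum _ fun i => ((hψ.tf t).pd hK i).mul ((hV.tf t).pd hK i)
    have Tf : TF K f := (T1.mul_left contDiff_const).add (T2.mul_left contDiff_const)
    have Tv := hV.tf t
    have Tlv := (hV.tf t).lap hK
    have Tlp := (hψ.tf t).lap hK
    have e : ∀ x, tderiv v t x = b * lap (v t) x + (c ^ 2 * lap (ψ t) x + f x) := by
      intro x
      by_cases hx : x ∈ Ω
      · have := heq t ht x hx
        rw [gdot_eq] at this
        simp only [← hv] at this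
        simp only [hf]
        linarith
      · have hx' : x ∉ K := fun h => hx (hKΩ h)
        rw [(hVt.tf t).zero hx', Tlv.zero hx', Tlp.zero hx', Tf.zero hx']
        simp
    have eint : ∀ g, TF K g → ∫ x, g x * tderiv v t x
        = b * (∫ x, g x * lap (v t) x) + c ^ 2 * (∫ x, g x * lap (ψ t) x) + ∫ x, f x * g x := by
      intro g hg
      have i1 := ((hg.mul Tlv).integrable hK).const_mul b
      have i2 := ((hg.mul Tlp).integrable hK).const_mul (c ^ 2)
      have i3 := (Tf.mul hg).integrable hK
      have i12 : Integrable (fun x => b * (g x * lap (v t) x)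
          + c ^ 2 * (g x * lap (ψ t) x)) := i1.add i2
      rw [← integral_const_mul, ← integral_const_mul, ← integral_add i1 i2,
        ← integral_add i12 i3]
      congr 1; ext x
      rw [e x]; ring
    have g1 : ∫ x, v t x * lap (v t) x = - q t := by
      have := green hK Tv Tv
      simp only [hq, sq]; linarith
    have g2 : ∫ x, v t x * lap (ψ t) x = - m t := by
      have := green hK Tv (hψ.tf t)
      simp only [hm]; linarith
    have j1 : Integrable (fun x => (v t x * lap (ψ t) x) ^ 2) :=
      (T1.pow 2 (by simp)).integrable hK
    have j2 : Integrable (fun x => (∑ i, pd i (ψ t) x * pd i (v t) x) ^ 2) :=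
      (T2.pow 2 (by simp)).integrable hK
    have hF : ∫ x, f x ^ 2 ≤ C0 * (8 * k ^ 2 * c ^ 4 + 8 * σ ^ 2) * s t * r t := by
      have b1 := (hst K hK hKΩ _ _ Tv (hψ.tf t)).2.2.1
      have b2 := (hst K hK hKΩ _ _ (hψ.tf t) Tv).2.2.2
      have b3 : ∫ x, f x ^ 2 ≤ ∫ x, ((8 * k ^ 2 * c ^ 4) * (v t x * lap (ψ t) x) ^ 2
          + (8 * σ ^ 2) * (∑ i, pd i (ψ t) x * pd i (v t) x) ^ 2) := by
        apply integral_mono ((Tf.pow 2 (by simp)).integrable hK)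
          ((j1.const_mul _).add (j2.const_mul _))
        intro x
        simp only [hf, Pi.add_apply]
        nlinarith [sq_nonneg (-(2 * k * c ^ 2) * (v t x * lap (ψ t) x)
          - -(2 * σ) * ∑ i, pd i (ψ t) x * pd i (v t) x)]
      rw [integral_add (j1.const_mul _) (j2.const_mul _), integral_const_mul,
        integral_const_mul] at b3
      have b4 := mul_le_mul_of_nonneg_left b1 (by positivity : 0 ≤ 8 * k ^ 2 * c ^ 4)
      have b5 := mul_le_mul_of_nonneg_left b2 (by positivity : 0 ≤ 8 * σ ^ 2)
      refine b3.trans ((add_le_add b4 b5).trans (le_of_eq ?_))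
      simp only [hs, hr]; ring
    have hs0 : 0 ≤ s t := nn _
    have hr0 : 0 ≤ r t := nn _
    have hp0 : 0 ≤ p t := Finset.sum_nonneg fun i _ => nn _
    have hq0 : 0 ≤ q t := Finset.sum_nonneg fun i _ => nn _
    have hF0 : 0 ≤ ∫ x, f x ^ 2 := nn _
    refine ⟨∫ x, lap (ψ t) x * lap (v t) x, ∫ x, f x ^ 2, ∫ x, f x * v t x,
      ∫ x, f x * lap (v t) x, ∫ x, f x * lap (ψ t) x, hF0, Tf.cs hK Tv, Tf.cs hK Tlv,
      Tf.cs hK Tlp, ?_, ?_, ?_, ?_, ?_, ?_, ?_⟩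
    · refine hF.trans ?_
      gcongr
      linarith
    · rw [eint _ Tv, g1, g2]; ring
    · congr 1
      simp only [hm]
      refine Finset.sum_congr rfl fun i _ => ?_
      congr 1; ext x; ring
    · have z1 := green hK (hVt.tf t) Tv
      have z2 : ∑ i, ∫ x, pd i (v t) x * pd i (tderiv v t) x
          = ∑ i, ∫ x, pd i (tderiv v t) x * pd i (v t) x := by
        refine Finset.sum_congr rfl fun i _ => ?_
        congr 1; ext x; ring
      have z3 : ∫ x, tderiv v t x * lap (v t) x = ∫ x, lap (v t) x * tderiv v t x := by
        congr 1; ext x; ring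
      have z4 : ∫ x, lap (v t) x * lap (ψ t) x = ∫ x, lap (ψ t) x * lap (v t) x := by
        congr 1; ext x; ring
      have z5 : ∫ x, lap (v t) x * lap (v t) x = s t := by simp only [hs, sq]
      rw [z2, z1, z3, eint _ Tlv, z4, z5]; ring
    · rfl
    · have z1 := green hK (hVt.tf t) (hψ.tf t)
      have z3 : ∫ x, tderiv v t x * lap (ψ t) x = ∫ x, lap (ψ t) x * tderiv v t x := by
        congr 1; ext x; ring
      have z5 : ∫ x, lap (ψ t) x * lap (ψ t) x = r t := by simp only [hr, sq]
      rw [z1, z3, eint _ Tlp, z5]; ring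
    · have k1 : Integrable (fun x => lap (v t) x ^ 2) := (Tlv.pow 2 (by simp)).integrable hK
      have k2 : Integrable (fun x => lap (ψ t) x ^ 2) := (Tlp.pow 2 (by simp)).integrable hK
      have k3 : Integrable (fun x => f x ^ 2) := (Tf.pow 2 (by simp)).integrable hK
      have k4 : Integrable (fun x => 3 * b ^ 2 * lap (v t) x ^ 2 + 3 * c ^ 4 * lap (ψ t) x ^ 2) :=
        (k1.const_mul _).add (k2.const_mul _)
      have hT : ∫ x, tderiv v t x ^ 2 ≤ ∫ x, ((3 * b ^ 2 * lap (v t) x ^ 2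
          + 3 * c ^ 4 * lap (ψ t) x ^ 2) + 3 * f x ^ 2) := by
        apply integral_mono (((hVt.tf t).pow 2 (by simp)).integrable hK)
          (k4.add (k3.const_mul _))
        intro x
        simp only [e x, Pi.add_apply]
        nlinarith [sq_nonneg (b * lap (v t) x - c ^ 2 * lap (ψ t) x),
          sq_nonneg (b * lap (v t) x - f x), sq_nonneg (c ^ 2 * lap (ψ t) x - f x)]
      rw [integral_add k4 (k3.const_mul _), integral_add (k1.const_mul _) (k2.const_mul _),
        integral_const_mul, integral_const_mul, integral_const_mul] at hT
      set F := ∫ x, f x ^ 2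
      have hT' : ∫ x, tderiv v t x ^ 2 ≤ 3 * b ^ 2 * s t + 3 * c ^ 4 * r t + 3 * F := hT
      have hC4 : 4 + 3 * b ^ 2 + 3 * c ^ 4 ≤ C := by linarith
      have hsum : 0 ≤ q t + s t + p t + r t + F := by positivity
      refine le_trans ?_ (mul_le_mul_of_nonneg_right hC4 hsum)
      have u1 : 0 ≤ 3 * b ^ 2 * (q t + p t + r t + F) := by positivity
      have u2 : 0 ≤ 3 * c ^ 4 * (q t + s t + p t + F) := by positivity
      simp only [hG]
      linarith
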